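/- Let m ∈ {0} ∪ ℕ and let E ⊆ ℤ satisfy E = −E = E + mℤ. Then the set of all two-colored partitions p such that the color distance between any two legs of the same block lies in mℤ, and such that any two points α₁, α₂ lying in two crossing blocks satisfy δ_p(α₁,α₂) ∉ E, is a category of two-colored partitions. -/

import Mathlib

noncomputable section
attribute [local instance] Classical.propDecidable

/-- A two-colored partition: two rows of points colored white (`true`) or black (`false`),
together with a set partition (setoid) of all points into blocks. -/
structure TCP where
  upper : ℕ
  lower : ℕ
  upColor : Fin upper → Bool
  loColor : Fin lower → Bool
  rel : Setoid (Fin upper ⊕ Fin lower)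

namespace TCP

/-- The points of a partition. -/
abbrev Point (p : TCP) := Fin p.upper ⊕ Fin p.lower

/-- Native color of a point. -/
def color (p : TCP) : p.Point → Bool
  | .inl j => p.upColor j
  | .inr i => p.loColor i

/-- Normalized color: inverted on the upper row. -/
def ncolor (p : TCP) : p.Point → Bool
  | .inl j => !(p.upColor j)
  | .inr i => p.loColor i

/-- Sign of a point: `+1` for normalized white, `-1` for normalized black. -/
def sgn (p : TCP) (x : p.Point) : ℤ := if p.ncolor x then 1 else -1

/-- Color sum of a finite set of points. -/
def csum (p : TCP) (S : Finset p.Point) : ℤ := ∑ x ∈ S, p.sgn x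

/-- Total color sum Σ(p). -/
def tsum (p : TCP) : ℤ := p.csum Finset.univ

/-- Total number of points. -/
def size (p : TCP) : ℕ := p.upper + p.lower

/-- Position in the counter-clockwise cyclic order: lower points left to right,
then upper points right to left. -/
def pos (p : TCP) : p.Point → ℕ
  | .inr i => i
  | .inl j => p.lower + (p.upper - 1 - j)

/-- Cyclic position of `y` relative to `x`. -/
def relpos (p : TCP) (x y : p.Point) : ℕ := (p.size + p.pos y - p.pos x) % p.size

/-- Half-open cyclic interval `]x,y]`. -/
def Ioc (p : TCP) (x y : p.Point) : Finset p.Point :=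
  Finset.univ.filter (fun z => 0 < p.relpos x z ∧ p.relpos x z ≤ p.relpos x y)

/-- Open cyclic interval `]x,y[`. -/
def Ioo (p : TCP) (x y : p.Point) : Finset p.Point :=
  Finset.univ.filter (fun z => 0 < p.relpos x z ∧ p.relpos x z < p.relpos x y)

/-- The color distance between two points. -/
def cdist (p : TCP) (x y : p.Point) : ℤ :=
  if x = y then p.tsum
  else if p.ncolor x = p.ncolor y then p.csum (p.Ioc x y)
  else p.csum (p.Ioo x y)

/-- The block of a point. -/
def blockOf (p : TCP) (x : p.Point) : Finset p.Point :=
  Finset.univ.filter (fun y => p.rel.r x y)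

/-- A finite set of points is a block of `p`. -/
def IsBlock (p : TCP) (B : Finset p.Point) : Prop := ∃ x, B = p.blockOf x

/-- `(a,b,c,d)` is ordered in the cyclic order of `p`. -/
def Ordered4 (p : TCP) (a b c d : p.Point) : Prop :=
  0 < p.relpos a b ∧ p.relpos a b < p.relpos a c ∧ p.relpos a c < p.relpos a d

/-- Two sets of points cross each other. -/
def Cross (p : TCP) (B₁ B₂ : Finset p.Point) : Prop :=
  ∃ a ∈ B₁, ∃ b ∈ B₁, ∃ a' ∈ B₂, ∃ b' ∈ B₂, p.Ordered4 a a' b b'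

/-! ### The analyzer -/

/-- Set of block sizes. -/
def Fset (S : Set TCP) : Set ℕ :=
  {n | ∃ p ∈ S, ∃ B : Finset p.Point, p.IsBlock B ∧ B.card = n}

/-- Set of block color sums. -/
def Vset (S : Set TCP) : Set ℤ :=
  {v | ∃ p ∈ S, ∃ B : Finset p.Point, p.IsBlock B ∧ p.csum B = v}

/-- Set of total color sums. -/
def Sset (S : Set TCP) : Set ℤ := {s | ∃ p ∈ S, p.tsum = s}

/-- Set of color distances between cyclically subsequent legs of the same block
having the same normalized color. -/
def Lset (S : Set TCP) : Set ℤ :=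
  {d | ∃ p ∈ S, ∃ B : Finset p.Point, p.IsBlock B ∧ ∃ a ∈ B, ∃ b ∈ B, a ≠ b ∧
        p.Ioo a b ∩ B = ∅ ∧ p.ncolor a = p.ncolor b ∧ p.cdist a b = d}

/-- Set of color distances between cyclically subsequent legs of the same block
having different normalized colors. -/
def Kset (S : Set TCP) : Set ℤ :=
  {d | ∃ p ∈ S, ∃ B : Finset p.Point, p.IsBlock B ∧ ∃ a ∈ B, ∃ b ∈ B, a ≠ b ∧
        p.Ioo a b ∩ B = ∅ ∧ p.ncolor a ≠ p.ncolor b ∧ p.cdist a b = d}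

/-- Set of color distances between legs of two crossing blocks. -/
def Xset (S : Set TCP) : Set ℤ :=
  {d | ∃ p ∈ S, ∃ B₁ B₂ : Finset p.Point, p.IsBlock B₁ ∧ p.IsBlock B₂ ∧ B₁ ≠ B₂ ∧
        p.Cross B₁ B₂ ∧ ∃ a ∈ B₁, ∃ b ∈ B₂, p.cdist a b = d}

/-- The parameter domain. -/
abbrev Param := Set ℕ × Set ℤ × Set ℤ × Set ℤ × Set ℤ × Set ℤ

/-- The analyzer `Z = (F, V, Σ, L, K, X)`. -/
def Z (S : Set TCP) : Param := (Fset S, Vset S, Sset S, Lset S, Kset S, Xset S)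

/-! ### Operations on partitions -/

/-- Componentwise relation on a sum type. -/
def sumRel {α β : Type*} (s : α → α → Prop) (t : β → β → Prop) : α ⊕ β → α ⊕ β → Prop
  | .inl a, .inl b => s a b
  | .inr a, .inr b => t a b
  | _, _ => False

/-- Componentwise setoid on a sum type. -/
def sumSetoid {α β : Type*} (s : Setoid α) (t : Setoid β) : Setoid (α ⊕ β) where
  r := sumRel s.r t.r
  iseqv := by
    refine ⟨?_, ?_, ?_⟩
    · rintro (a | a) <;> exact Setoid.refl _
    · rintro (a | a) (b | b) h <;> first | exact Setoid.symm h | exact h.elim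
    · rintro (a | a) (b | b) (c | c) h₁ h₂ <;>
        first | exact Setoid.trans h₁ h₂ | exact h₁.elim | exact h₂.elim

/-- Identification of the points of a tensor product with a sum of points. -/
def ptmap (p q : TCP) :
    (Fin (p.upper + q.upper) ⊕ Fin (p.lower + q.lower)) → (p.Point ⊕ q.Point)
  | .inl j => (finSumFinEquiv.symm j).elim (fun a => .inl (.inl a)) (fun a => .inr (.inl a))
  | .inr i => (finSumFinEquiv.symm i).elim (fun a => .inl (.inr a)) (fun a => .inr (.inr a))

/-- Tensor product: horizontal concatenation. -/
def tensor (p q : TCP) : TCP where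
  upper := p.upper + q.upper
  lower := p.lower + q.lower
  upColor := fun j => (finSumFinEquiv.symm j).elim p.upColor q.upColor
  loColor := fun i => (finSumFinEquiv.symm i).elim p.loColor q.loColor
  rel := Setoid.comap (ptmap p q) (sumSetoid p.rel q.rel)

/-- Embedding of the points of `p` into the points of `p.tensor q`. -/
def tinl (p q : TCP) : p.Point → (p.tensor q).Point
  | .inl j => Sum.inl (Fin.castAdd q.upper j)
  | .inr i => Sum.inr (Fin.castAdd q.lower i)

/-- Embedding of the points of `q` into the points of `p.tensor q`. -/
def tinr (p q : TCP) : q.Point → (p.tensor q).Point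
  | .inl j => Sum.inl (Fin.natAdd p.upper j)
  | .inr i => Sum.inr (Fin.natAdd p.lower i)

/-- Involution: swapping the rows. -/
def invol (p : TCP) : TCP where
  upper := p.lower
  lower := p.upper
  upColor := p.loColor
  loColor := p.upColor
  rel := Setoid.comap Sum.swap p.rel

/-- `(p, q)` is composable: the upper row of `p` matches the lower row of `q`. -/
structure Composable (p q : TCP) : Prop where
  len : p.upper = q.lower
  col : ∀ j : Fin p.upper, p.upColor j = q.loColor (Fin.cast len j)

/-- Generating relation for the composition of `p` and `q`. -/
def compRel (p q : TCP) (h : p.upper = q.lower) :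
    (q.Point ⊕ p.Point) → (q.Point ⊕ p.Point) → Prop := fun x y =>
  (∃ a b, x = .inl a ∧ y = .inl b ∧ q.rel.r a b) ∨
  (∃ a b, x = .inr a ∧ y = .inr b ∧ p.rel.r a b) ∨
  (∃ j : Fin p.upper, x = .inl (.inr (Fin.cast h j)) ∧ y = .inr (.inl j)) ∨
  (∃ j : Fin p.upper, y = .inl (.inr (Fin.cast h j)) ∧ x = .inr (.inl j))

/-- Composition: vertical concatenation, with blocks joined along the middle row. -/
def comp (p q : TCP) (h : Composable p q) : TCP where
  upper := q.upper
  lower := p.lower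
  upColor := q.upColor
  loColor := p.loColor
  rel := Setoid.comap
    (fun x : Fin q.upper ⊕ Fin p.lower => match x with
      | .inl j => Sum.inl (Sum.inl j : q.Point)
      | .inr i => Sum.inr (Sum.inr i : p.Point))
    (Relation.EqvGen.setoid (compRel p q h.len))

/-- The empty partition. -/
def emptyP : TCP := ⟨0, 0, Fin.elim0, Fin.elim0, ⊤⟩

/-- The identity partition of color `c`: one upper and one lower point of color `c`
joined in one block. -/
def idPart (c : Bool) : TCP := ⟨1, 1, fun _ => c, fun _ => c, ⊤⟩

/-- The one-row pair partition with two lower points of colors `c₁`, `c₂` in one block. -/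
def lpair (c₁ c₂ : Bool) : TCP := ⟨0, 2, Fin.elim0, fun i => if i = 0 then c₁ else c₂, ⊤⟩

/-- A category of two-colored partitions. -/
def IsCategory (C : Set TCP) : Prop :=
  emptyP ∈ C ∧ idPart true ∈ C ∧ idPart false ∈ C ∧
  lpair true false ∈ C ∧ lpair false true ∈ C ∧
  (∀ p q, p ∈ C → q ∈ C → p.tensor q ∈ C) ∧
  (∀ p, p ∈ C → p.invol ∈ C) ∧
  (∀ p q (h : Composable p q), p ∈ C → q ∈ C → comp p q h ∈ C)

/-! ### Rotations, verticolor reflection, erasing -/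

/-- Rotate the leftmost upper point down (identity if the upper row is empty). -/
def rotDownL (p : TCP) : TCP :=
  if h : 0 < p.upper then
    { upper := p.upper - 1
      lower := p.lower + 1
      upColor := fun j => p.upColor ⟨j + 1, by have := j.isLt; omega⟩
      loColor := fun i => Fin.cases (!(p.upColor ⟨0, h⟩)) (fun i' => p.loColor i') i
      rel := Setoid.comap
        (fun x : Fin (p.upper - 1) ⊕ Fin (p.lower + 1) => match x with
          | .inl j => (Sum.inl ⟨j + 1, by have := j.isLt; omega⟩ : p.Point)
          | .inr i => Fin.cases (Sum.inl ⟨0, h⟩ : p.Point) (fun i' => (Sum.inr i' : p.Point)) i)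
        p.rel }
  else p

/-- Rotate the rightmost upper point down (identity if the upper row is empty). -/
def rotDownR (p : TCP) : TCP :=
  if h : 0 < p.upper then
    { upper := p.upper - 1
      lower := p.lower + 1
      upColor := fun j => p.upColor ⟨j, by have := j.isLt; omega⟩
      loColor := fun i =>
        Fin.lastCases (!(p.upColor ⟨p.upper - 1, by omega⟩)) (fun i' => p.loColor i') i
      rel := Setoid.comap
        (fun x : Fin (p.upper - 1) ⊕ Fin (p.lower + 1) => match x with
          | .inl j => (Sum.inl ⟨j, by have := j.isLt; omega⟩ : p.Point)
          | .inr i => Fin.lastCases (Sum.inl ⟨p.upper - 1, by omega⟩ : p.Point)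
              (fun i' => (Sum.inr i' : p.Point)) i)
        p.rel }
  else p

/-- Rotate the leftmost lower point up (identity if the lower row is empty). -/
def rotUpL (p : TCP) : TCP :=
  if h : 0 < p.lower then
    { upper := p.upper + 1
      lower := p.lower - 1
      upColor := fun j => Fin.cases (!(p.loColor ⟨0, h⟩)) (fun j' => p.upColor j') j
      loColor := fun i => p.loColor ⟨i + 1, by have := i.isLt; omega⟩
      rel := Setoid.comap
        (fun x : Fin (p.upper + 1) ⊕ Fin (p.lower - 1) => match x with
          | .inl j => Fin.cases (Sum.inr ⟨0, h⟩ : p.Point) (fun j' => (Sum.inl j' : p.Point)) j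
          | .inr i => (Sum.inr ⟨i + 1, by have := i.isLt; omega⟩ : p.Point))
        p.rel }
  else p

/-- Rotate the rightmost lower point up (identity if the lower row is empty). -/
def rotUpR (p : TCP) : TCP :=
  if h : 0 < p.lower then
    { upper := p.upper + 1
      lower := p.lower - 1
      upColor := fun j =>
        Fin.lastCases (!(p.loColor ⟨p.lower - 1, by omega⟩)) (fun j' => p.upColor j') j
      loColor := fun i => p.loColor ⟨i, by have := i.isLt; omega⟩
      rel := Setoid.comap
        (fun x : Fin (p.upper + 1) ⊕ Fin (p.lower - 1) => match x with
          | .inl j => Fin.lastCases (Sum.inr ⟨p.lower - 1, by omega⟩ : p.Point)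
              (fun j' => (Sum.inl j' : p.Point)) j
          | .inr i => (Sum.inr ⟨i, by have := i.isLt; omega⟩ : p.Point))
        p.rel }
  else p

/-- Verticolor reflection: reverse both rows and invert all colors. -/
def vreflect (p : TCP) : TCP where
  upper := p.upper
  lower := p.lower
  upColor := fun j => !(p.upColor j.rev)
  loColor := fun i => !(p.loColor i.rev)
  rel := Setoid.comap (Sum.map Fin.rev Fin.rev) p.rel

/-- `{a, b}` is a turn: two cyclically consecutive points of inverse normalized colors. -/
def IsTurn (p : TCP) (a b : p.Point) : Prop :=
  p.relpos a b = 1 ∧ p.ncolor a ≠ p.ncolor b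

/-- `e` identifies the points of `q` with the points of `p` outside `{a, b}`, preserving
rows, colors and order, and `q` carries the block structure obtained from `p` by erasing
`{a, b}` and merging all blocks meeting `{a, b}`. -/
def IsErasingMap (p : TCP) (a b : p.Point) (q : TCP) (e : q.Point → p.Point) : Prop :=
  Function.Injective e ∧
  Set.range e = {x | x ≠ a ∧ x ≠ b} ∧
  (∀ j : Fin q.upper, ∃ j', e (.inl j) = Sum.inl j') ∧
  (∀ i : Fin q.lower, ∃ i', e (.inr i) = Sum.inr i') ∧
  (∀ j₁ j₂ : Fin q.upper, ∀ j₁' j₂' : Fin p.upper,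
    e (.inl j₁) = Sum.inl j₁' → e (.inl j₂) = Sum.inl j₂' → (j₁ < j₂ ↔ j₁' < j₂')) ∧
  (∀ i₁ i₂ : Fin q.lower, ∀ i₁' i₂' : Fin p.lower,
    e (.inr i₁) = Sum.inr i₁' → e (.inr i₂) = Sum.inr i₂' → (i₁ < i₂ ↔ i₁' < i₂')) ∧
  (∀ x, q.color x = p.color (e x)) ∧
  (∀ x y, q.rel.r x y ↔
    (p.rel.r (e x) (e y) ∨
      ((p.rel.r (e x) a ∨ p.rel.r (e x) b) ∧ (p.rel.r (e y) a ∨ p.rel.r (e y) b))))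

/-- `q` is obtained from `p` by erasing the turn `{a, b}`. -/
def IsErasing (p : TCP) (a b : p.Point) (q : TCP) : Prop :=
  p.IsTurn a b ∧ ∃ e : q.Point → p.Point, IsErasingMap p a b q e

end TCP

namespace TCP

/-! ### Reformulation via row heights -/

/-- Sign of a native color. -/
def sg (c : Bool) : ℤ := if c then 1 else -1

/-- Height of a point in a row of colors, read from left to right. -/
def rh (n : ℕ) (col : Fin n → Bool) (i : Fin n) : ℤ :=
  (∑ j : Fin n, if j < i then sg (col j) else 0) + (if col i then 0 else -1)

/-- Row sum of native colors. -/
def rsum (n : ℕ) (col : Fin n → Bool) : ℤ := ∑ j : Fin n, sg (col j)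

/-- Height of a point. -/
def wt (p : TCP) : p.Point → ℤ
  | .inl j => rh p.upper p.upColor j
  | .inr i => rh p.lower p.loColor i

/-- Reformulated membership. -/
structure Good (m : ℕ) (E : Set ℤ) (p : TCP) : Prop where
  tot : (m : ℤ) ∣ rsum p.lower p.loColor - rsum p.upper p.upColor
  blk : ∀ x y, p.rel.r x y → (m : ℤ) ∣ p.wt y - p.wt x
  crs : ∀ x c y d, p.rel.r x y → p.rel.r c d → ¬ p.rel.r x c →
    p.pos x < p.pos c → p.pos c < p.pos y → p.pos y < p.pos d → p.wt c - p.wt x ∉ E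

theorem pos_lt (p : TCP) (x : p.Point) : p.pos x < p.size := by
  rcases x with ⟨j, hj⟩ | ⟨i, hi⟩ <;> simp only [pos, size] <;> omega

theorem pos_inj (p : TCP) {x y : p.Point} (h : p.pos x = p.pos y) : x = y := by
  rcases x with ⟨j, hj⟩ | ⟨i, hi⟩ <;> rcases y with ⟨j', hj'⟩ | ⟨i', hi'⟩ <;>
    simp only [pos] at h <;> first | omega | (congr 2; omega) | (congr 2)

theorem relpos_eq (p : TCP) (x y : p.Point) :
    p.relpos x y = if p.pos x ≤ p.pos y then p.pos y - p.pos x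
      else p.size + p.pos y - p.pos x := by
  have hx := p.pos_lt x
  have hy := p.pos_lt y
  unfold relpos
  split_ifs with h
  · rw [show p.size + p.pos y - p.pos x = p.size + (p.pos y - p.pos x) by omega,
      Nat.add_mod_left, Nat.mod_eq_of_lt (by omega)]
  · rw [Nat.mod_eq_of_lt (by omega)]

/-- Prefix sums. -/
def pre (p : TCP) (x : p.Point) : ℤ := ∑ z, if p.pos z ≤ p.pos x then p.sgn z else 0

theorem csum_Ioc (p : TCP) (x y : p.Point) (h : x ≠ y) :
    p.csum (p.Ioc x y) = p.pre y - p.pre x + if p.pos y < p.pos x then p.tsum else 0 := by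
  have hne : p.pos x ≠ p.pos y := fun e => h (p.pos_inj e)
  have hx := p.pos_lt x
  have hy := p.pos_lt y
  have e1 : (if p.pos y < p.pos x then p.tsum else 0)
      = ∑ z, if p.pos y < p.pos x then p.sgn z else 0 := by
    split_ifs
    · rfl
    · simp
  rw [e1]
  unfold csum Ioc pre
  rw [Finset.sum_filter, ← Finset.sum_sub_distrib, ← Finset.sum_add_distrib]
  refine Finset.sum_congr rfl fun z _ => ?_
  have hz := p.pos_lt z
  rw [relpos_eq, relpos_eq]
  split_ifs <;> omega

theorem csum_Ioo (p : TCP) (x y : p.Point) (h : x ≠ y) :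
    p.csum (p.Ioo x y) = p.csum (p.Ioc x y) - p.sgn y := by
  have hne : p.pos x ≠ p.pos y := fun e => h (p.pos_inj e)
  have hx := p.pos_lt x
  have hy := p.pos_lt y
  have hmem : y ∈ p.Ioc x y := by
    simp only [Ioc, Finset.mem_filter, Finset.mem_univ, true_and, le_refl, and_true, relpos_eq]
    split_ifs <;> omega
  have : p.Ioo x y = (p.Ioc x y).erase y := by
    ext z
    have hz := p.pos_lt z
    have hzy : z = y ↔ p.pos z = p.pos y := ⟨fun e => e ▸ rfl, p.pos_inj⟩
    simp only [Ioo, Ioc, Finset.mem_erase, Finset.mem_filter, Finset.mem_univ, true_and, ne_eq,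
      hzy, relpos_eq]
    split_ifs <;> omega
  rw [this]
  unfold csum
  rw [← Finset.add_sum_erase _ _ hmem]
  ring

theorem tsum_eq (p : TCP) :
    p.tsum = rsum p.lower p.loColor - rsum p.upper p.upColor := by
  unfold tsum csum rsum
  rw [Fintype.sum_sum_type, sub_eq_neg_add, ← Finset.sum_neg_distrib]
  congr 1
  · refine Finset.sum_congr rfl fun j _ => ?_
    simp only [sgn, ncolor, sg]
    by_cases h : p.upColor j = true <;> simp [h]

theorem pre_eq (p : TCP) (x : p.Point) :
    ∃ k : ℤ, p.pre x = p.wt x + (if p.ncolor x then 1 else 0) + k * p.tsum := by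
  rcases x with j | i
  · refine ⟨1, ?_⟩
    rw [tsum_eq]
    unfold pre wt rh rsum
    rw [Fintype.sum_sum_type]
    have hl : ∑ i : Fin p.lower, (if p.pos (Sum.inr i : p.Point) ≤ p.pos (Sum.inl j : p.Point)
        then p.sgn (Sum.inr i) else 0) = ∑ i, sg (p.loColor i) := by
      refine Finset.sum_congr rfl fun i _ => ?_
      rw [if_pos (by simp only [pos]; omega)]
      rfl
    have hu : ∑ i : Fin p.upper, (if p.pos (Sum.inl i : p.Point) ≤ p.pos (Sum.inl j : p.Point)
        then p.sgn (Sum.inl i) else 0) = (∑ i, if i < j then sg (p.upColor i) else 0)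
          - ∑ i, sg (p.upColor i) := by
      rw [← Finset.sum_sub_distrib]
      refine Finset.sum_congr rfl fun i _ => ?_
      have := i.isLt
      have := j.isLt
      by_cases hlt : i < j
      · have hn : ¬ p.pos (Sum.inl i : p.Point) ≤ p.pos (Sum.inl j : p.Point) := by
          simp only [pos]
          omega
        rw [if_pos hlt, if_neg hn]
        ring
      · have hn : p.pos (Sum.inl i : p.Point) ≤ p.pos (Sum.inl j : p.Point) := by
          simp only [pos]
          omega
        rw [if_neg hlt, if_pos hn]
        simp only [sgn, ncolor, sg]
        by_cases h : p.upColor i = true <;> simp [h]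
    rw [hl, hu]
    simp only [ncolor]
    by_cases h : p.upColor j = true <;> simp [h] <;> ring
  · refine ⟨0, ?_⟩
    unfold pre wt rh
    rw [Fintype.sum_sum_type]
    have hl : ∑ k : Fin p.lower, (if p.pos (Sum.inr k : p.Point) ≤ p.pos (Sum.inr i : p.Point)
        then p.sgn (Sum.inr k) else 0) = (∑ k, if k < i then sg (p.loColor k) else 0)
          + ∑ k, if k = i then sg (p.loColor k) else 0 := by
      rw [← Finset.sum_add_distrib]
      refine Finset.sum_congr rfl fun k _ => ?_
      change (if (k : ℕ) ≤ i then sg (p.loColor k) else 0) = _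
      simp only [Fin.lt_def, Fin.ext_iff]
      rcases lt_trichotomy (k : ℕ) i with h | h | h
      · rw [if_pos h.le, if_pos h, if_neg h.ne, add_zero]
      · rw [if_pos h.le, if_neg (by omega), if_pos h, zero_add]
      · rw [if_neg (by omega), if_neg (by omega), if_neg (by omega), add_zero]
    have hu : ∑ j : Fin p.upper, (if p.pos (Sum.inl j : p.Point) ≤ p.pos (Sum.inr i : p.Point)
        then p.sgn (Sum.inl j) else 0) = 0 := by
      refine Finset.sum_eq_zero fun j _ => ?_
      rw [if_neg (by simp only [pos]; omega)]
    rw [hl, hu, Finset.sum_ite_eq' Finset.univ i (fun k => sg (p.loColor k))]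
    simp only [ncolor, sg]
    by_cases h : p.loColor i = true <;> simp [h]

theorem cdist_eq (p : TCP) (x y : p.Point) :
    ∃ k : ℤ, p.cdist x y = p.wt y - p.wt x + k * p.tsum := by
  obtain ⟨k, hk⟩ := p.pre_eq x
  obtain ⟨l, hl⟩ := p.pre_eq y
  by_cases h : x = y
  · subst h
    exact ⟨1, by simp [cdist]⟩
  · have h1 := p.csum_Ioc x y h
    have h2 := p.csum_Ioo x y h
    refine ⟨l - k + (if p.pos y < p.pos x then 1 else 0), ?_⟩
    unfold cdist
    rw [if_neg h, h2, h1, hk, hl]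
    unfold sgn
    cases p.ncolor x <;> cases p.ncolor y <;> by_cases h3 : p.pos y < p.pos x <;> simp [h3] <;> ring

theorem mem_block (p : TCP) (x y : p.Point) : y ∈ p.blockOf x ↔ p.rel.r x y := by
  simp [blockOf]

theorem good_iff (m : ℕ) (E : Set ℤ) (hE1 : ∀ x : ℤ, x ∈ E ↔ -x ∈ E)
    (hE2 : ∀ x k : ℤ, x ∈ E → x + m * k ∈ E) (p : TCP) :
    ((∀ B : Finset p.Point, p.IsBlock B → ∀ a ∈ B, ∀ b ∈ B, (m : ℤ) ∣ p.cdist a b) ∧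
      (∀ B₁ B₂ : Finset p.Point, p.IsBlock B₁ → p.IsBlock B₂ → B₁ ≠ B₂ →
        p.Cross B₁ B₂ → ∀ a ∈ B₁, ∀ b ∈ B₂, p.cdist a b ∉ E)) ↔ Good m E p := by
  constructor
  · rintro ⟨h1, h2⟩
    have ht : ∀ _ : p.Point, (m : ℤ) ∣ p.tsum := by
      intro x
      have hx : x ∈ p.blockOf x := (p.mem_block x x).2 (p.rel.refl x)
      simpa [cdist] using h1 _ ⟨x, rfl⟩ x hx x hx
    refine ⟨?_, ?_, ?_⟩
    · rw [← tsum_eq]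
      by_cases hne : Nonempty p.Point
      · exact ht hne.some
      · have : IsEmpty p.Point := not_nonempty_iff.1 hne
        simp [tsum, csum]
    · intro x y hxy
      have := h1 _ ⟨x, rfl⟩ x ((p.mem_block x x).2 (p.rel.refl x)) y ((p.mem_block x y).2 hxy)
      obtain ⟨k, hk⟩ := p.cdist_eq x y
      rw [hk] at this
      exact (dvd_add_left (Dvd.dvd.mul_left (ht x) k)).1 this
    · intro x c y d hxy hcd hxc l1 l2 l3 hE
      have := h2 (p.blockOf x) (p.blockOf c) ⟨x, rfl⟩ ⟨c, rfl⟩ (fun e => hxc (by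
          rw [← mem_block, e, mem_block]))
        ⟨x, (p.mem_block x x).2 (p.rel.refl x), y, (p.mem_block x y).2 hxy,
          c, (p.mem_block c c).2 (p.rel.refl c), d, (p.mem_block c d).2 hcd, by
            unfold Ordered4
            simp only [relpos_eq]
            split_ifs <;> omega⟩ x ((p.mem_block x x).2 (p.rel.refl x)) c
              ((p.mem_block c c).2 (p.rel.refl c))
      apply this
      obtain ⟨k, hk⟩ := p.cdist_eq x c
      obtain ⟨t, ht⟩ := ht x
      rw [hk, ht]
      have := hE2 _ (k * t) hE
      convert this using 1
      ring
  · rintro ⟨h1, h2, h3⟩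
    rw [← tsum_eq] at h1
    constructor
    · rintro B ⟨x, rfl⟩ a ha b hb
      rw [mem_block] at ha hb
      obtain ⟨k, hk⟩ := p.cdist_eq a b
      rw [hk]
      exact dvd_add (h2 _ _ (p.rel.trans (p.rel.symm ha) hb)) (Dvd.dvd.mul_left h1 k)
    · rintro B₁ B₂ ⟨x, rfl⟩ ⟨y, rfl⟩ hne ⟨a, ha, b, hb, a', ha', b', hb', ho⟩ s hs t ht hE
      rw [mem_block] at ha hb ha' hb' hs ht
      have hxy : ¬ p.rel.r x y := by
        intro hxy
        apply hne
        ext z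
        rw [mem_block, mem_block]
        exact ⟨fun h => p.rel.trans (p.rel.symm hxy) h, fun h => p.rel.trans hxy h⟩
      have key1 : ∀ u v, p.rel.r x u → p.rel.r y v → p.wt v - p.wt u ∈ E := by
        intro u v hu hv
        obtain ⟨k, hk⟩ := p.cdist_eq s t
        obtain ⟨k', hk'⟩ := h1
        obtain ⟨k1, hk1⟩ := h2 _ _ (p.rel.trans (p.rel.symm hs) hu)
        obtain ⟨k2, hk2⟩ := h2 _ _ (p.rel.trans (p.rel.symm ht) hv)
        have := hE2 _ (k2 - k1 - k * k') hE
        convert this using 1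
        rw [hk, hk']
        linear_combination hk2 - hk1
      have key2 : ∀ u v, p.rel.r x u → p.rel.r y v → p.wt u - p.wt v ∈ E := by
        intro u v hu hv
        rw [hE1, neg_sub]
        exact key1 u v hu hv
      have hn1 : ∀ u v, p.rel.r x u → p.rel.r y v → ¬ p.rel.r u v := fun u v hu hv huv =>
        hxy (p.rel.trans hu (p.rel.trans huv (p.rel.symm hv)))
      have hn2 : ∀ u v, p.rel.r x u → p.rel.r y v → ¬ p.rel.r v u := fun u v hu hv huv =>
        hn1 u v hu hv (p.rel.symm huv)
      have rab := p.rel.trans (p.rel.symm ha) hb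
      have rba := p.rel.symm rab
      have rab' := p.rel.trans (p.rel.symm ha') hb'
      have rba' := p.rel.symm rab'
      have la := p.pos_lt a
      have lb := p.pos_lt b
      have la' := p.pos_lt a'
      have lb' := p.pos_lt b'
      have ho' : (p.pos a < p.pos a' ∧ p.pos a' < p.pos b ∧ p.pos b < p.pos b') ∨
          (p.pos a' < p.pos b ∧ p.pos b < p.pos b' ∧ p.pos b' < p.pos a) ∨
          (p.pos b < p.pos b' ∧ p.pos b' < p.pos a ∧ p.pos a < p.pos a') ∨
          (p.pos b' < p.pos a ∧ p.pos a < p.pos a' ∧ p.pos a' < p.pos b) := by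
        unfold Ordered4 at ho
        simp only [relpos_eq] at ho
        split_ifs at ho <;> omega
      rcases ho' with ⟨l1, l2, l3⟩ | ⟨l1, l2, l3⟩ | ⟨l1, l2, l3⟩ | ⟨l1, l2, l3⟩
      · exact h3 a a' b b' rab rab' (hn1 _ _ ha ha') l1 l2 l3 (key1 _ _ ha ha')
      · exact h3 a' b b' a rab' rba (hn2 _ _ hb ha') l1 l2 l3 (key2 _ _ hb ha')
      · exact h3 b b' a a' rba rba' (hn1 _ _ hb hb') l1 l2 l3 (key1 _ _ hb hb')
      · exact h3 b' a a' b rba' rab (hn2 _ _ ha hb') l1 l2 l3 (key2 _ _ ha hb')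


theorem good_empty (m : ℕ) (E : Set ℤ) : Good m E emptyP := by
  refine ⟨?_, ?_, ?_⟩
  · change (m : ℤ) ∣ rsum 0 Fin.elim0 - rsum 0 Fin.elim0
    simp
  · rintro (x | x) <;> exact x.elim0
  · rintro (x | x) <;> exact x.elim0

theorem good_id (m : ℕ) (E : Set ℤ) (c : Bool) : Good m E (idPart c) := by
  refine ⟨?_, ?_, ?_⟩
  · change (m : ℤ) ∣ rsum 1 (fun _ => c) - rsum 1 (fun _ => c)
    simp
  · intro x y _
    have key : ∀ z : (idPart c).Point, (idPart c).wt z = rh 1 (fun _ => c) 0 := by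
      rintro (z | z)
      · change rh 1 (fun _ => c) z = _
        exact congrArg _ (Subsingleton.elim (α := Fin 1) z 0)
      · change rh 1 (fun _ => c) z = _
        exact congrArg _ (Subsingleton.elim (α := Fin 1) z 0)
    rw [key, key]
    simp
  · intro x c y d _ _ h
    exact (h trivial).elim

theorem good_lpair (m : ℕ) (E : Set ℤ) (c : Bool) : Good m E (lpair c (!c)) := by
  refine ⟨?_, ?_, ?_⟩
  · change (m : ℤ) ∣ rsum 2 (fun i => if i = 0 then c else !c) - rsum 0 Fin.elim0
    simp only [rsum, Fin.sum_univ_two, sg]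
    cases c <;> simp
  · intro x y _
    have key : ∀ z : (lpair c (!c)).Point,
        (lpair c (!c)).wt z = rh 2 (fun i => if i = 0 then c else !c) 0 := by
      rintro (z | z)
      · exact Fin.elim0 z
      · change rh 2 (fun i => if i = 0 then c else !c) z = _
        fin_cases z
        · rfl
        · change rh 2 (fun i => if i = 0 then c else !c) 1 = _
          simp only [rh, Fin.sum_univ_two, sg]
          cases c <;> simp
    rw [key, key]
    simp
  · intro x c y d _ _ h
    exact (h trivial).elim

/-! ### Involution -/

theorem good_invol (m : ℕ) (E : Set ℤ) (hE1 : ∀ x : ℤ, x ∈ E ↔ -x ∈ E)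
    (hE2 : ∀ x k : ℤ, x ∈ E → x + m * k ∈ E) (p : TCP) (hp : Good m E p) :
    Good m E p.invol := by
  have hw : ∀ x : p.invol.Point, p.invol.wt x = p.wt (Sum.swap x) := by
    rintro (x | x) <;> rfl
  have hpos : ∀ x : p.invol.Point, p.invol.pos x + p.pos (Sum.swap x) + 1 = p.size := by
    rintro (⟨x, hx⟩ | ⟨x, hx⟩)
    · change p.upper + (p.lower - 1 - x) + x + 1 = p.upper + p.lower
      change x < p.lower at hx
      omega
    · change x + (p.lower + (p.upper - 1 - x)) + 1 = p.upper + p.lower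
      change x < p.upper at hx
      omega
  refine ⟨?_, ?_, ?_⟩
  · have := hp.tot
    rw [← dvd_neg, neg_sub] at this
    exact this
  · intro x y hxy
    rw [hw, hw]
    exact hp.blk _ _ hxy
  · intro x c y d hxy hcd hxc l1 l2 l3 hE
    have h1 := hpos x
    have h2 := hpos c
    have h3 := hpos y
    have h4 := hpos d
    change p.rel.r (Sum.swap x) (Sum.swap y) at hxy
    change p.rel.r (Sum.swap c) (Sum.swap d) at hcd
    change ¬ p.rel.r (Sum.swap x) (Sum.swap c) at hxc
    refine hp.crs (Sum.swap d) (Sum.swap y) (Sum.swap c) (Sum.swap x) (p.rel.symm hcd)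
      (p.rel.symm hxy) (fun h => hxc ?_) (by omega) (by omega) (by omega) ?_
    · exact p.rel.trans hxy (p.rel.trans (p.rel.symm h) (p.rel.symm hcd))
    · rw [hw, hw, hE1] at hE
      obtain ⟨k1, hk1⟩ := hp.blk _ _ hxy
      obtain ⟨k2, hk2⟩ := hp.blk _ _ hcd
      have := hE2 _ (k1 - k2) hE
      convert this using 1
      linear_combination hk1 - hk2

/-! ### Tensor product -/

theorem rsum_add (a b : ℕ) (f : Fin a → Bool) (g : Fin b → Bool) :
    rsum (a + b) (fun j => (finSumFinEquiv.symm j).elim f g) = rsum a f + rsum b g := by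
  simp [rsum, Fin.sum_univ_add]

theorem rh_castAdd (a b : ℕ) (f : Fin a → Bool) (g : Fin b → Bool) (i : Fin a) :
    rh (a + b) (fun j => (finSumFinEquiv.symm j).elim f g) (Fin.castAdd b i) = rh a f i := by
  have h : ∀ j : Fin b, ¬ Fin.natAdd a j < Fin.castAdd b i := by
    intro j
    simp only [Fin.lt_def, Fin.val_natAdd, Fin.val_castAdd]
    omega
  have h' : ∀ j : Fin a, Fin.castAdd b j < Fin.castAdd b i ↔ j < i := fun _ => Iff.rfl
  simp [rh, Fin.sum_univ_add, h, h']

theorem rh_natAdd (a b : ℕ) (f : Fin a → Bool) (g : Fin b → Bool) (i : Fin b) :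
    rh (a + b) (fun j => (finSumFinEquiv.symm j).elim f g) (Fin.natAdd a i)
      = rsum a f + rh b g i := by
  have h : ∀ j : Fin a, Fin.castAdd b j < Fin.natAdd a i := by
    intro j
    simp only [Fin.lt_def, Fin.val_natAdd, Fin.val_castAdd]
    omega
  simp [rh, rsum, Fin.sum_univ_add, h, add_assoc]

theorem tensor_cases (p q : TCP) (x : (p.tensor q).Point) :
    (∃ a, x = tinl p q a) ∨ (∃ a, x = tinr p q a) := by
  rcases x with x | x
  · change Fin (p.upper + q.upper) at x
    refine Fin.addCases (fun i => ?_) (fun i => ?_) x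
    · exact Or.inl ⟨Sum.inl i, rfl⟩
    · exact Or.inr ⟨Sum.inl i, rfl⟩
  · change Fin (p.lower + q.lower) at x
    refine Fin.addCases (fun i => ?_) (fun i => ?_) x
    · exact Or.inl ⟨Sum.inr i, rfl⟩
    · exact Or.inr ⟨Sum.inr i, rfl⟩

theorem ptmap_tinl (p q : TCP) (a : p.Point) : ptmap p q (tinl p q a) = Sum.inl a := by
  rcases a with a | a <;> simp [ptmap, tinl]

theorem ptmap_tinr (p q : TCP) (a : q.Point) : ptmap p q (tinr p q a) = Sum.inr a := by
  rcases a with a | a <;> simp [ptmap, tinr]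

theorem tensor_rel (p q : TCP) (x y : (p.tensor q).Point) :
    (p.tensor q).rel.r x y ↔ sumRel p.rel.r q.rel.r (ptmap p q x) (ptmap p q y) := Iff.rfl

theorem wt_tinl (p q : TCP) (a : p.Point) : (p.tensor q).wt (tinl p q a) = p.wt a := by
  rcases a with a | a
  · exact rh_castAdd _ _ _ _ _
  · exact rh_castAdd _ _ _ _ _

theorem wt_tinr (p q : TCP) (m : ℕ)
    (hp : (m : ℤ) ∣ rsum p.lower p.loColor - rsum p.upper p.upColor) (a : q.Point) :
    ∃ k : ℤ, (p.tensor q).wt (tinr p q a) = q.wt a + rsum p.lower p.loColor + m * k := by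
  obtain ⟨k, hk⟩ := hp
  rcases a with a | a
  · refine ⟨-k, ?_⟩
    have : (p.tensor q).wt (tinr p q (Sum.inl a)) = rsum p.upper p.upColor + q.wt (Sum.inl a) :=
      rh_natAdd _ _ _ _ _
    rw [this]
    linear_combination -hk
  · refine ⟨0, ?_⟩
    have : (p.tensor q).wt (tinr p q (Sum.inr a)) = rsum p.lower p.loColor + q.wt (Sum.inr a) :=
      rh_natAdd _ _ _ _ _
    rw [this]
    ring

theorem pos_tinl (p q : TCP) (a : p.Point) :
    (p.pos a < p.lower ∧ (p.tensor q).pos (tinl p q a) = p.pos a) ∨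
    (p.lower ≤ p.pos a ∧ (p.tensor q).pos (tinl p q a) = p.pos a + q.size) := by
  rcases a with ⟨a, ha⟩ | ⟨a, ha⟩
  · right
    refine ⟨by simp only [pos]; omega, ?_⟩
    change (p.lower + q.lower) + ((p.upper + q.upper) - 1 - a)
      = p.lower + (p.upper - 1 - a) + (q.upper + q.lower)
    omega
  · left
    exact ⟨ha, rfl⟩

theorem pos_tinr (p q : TCP) (a : q.Point) :
    (p.tensor q).pos (tinr p q a) = q.pos a + p.lower := by
  rcases a with ⟨a, ha⟩ | ⟨a, ha⟩
  · change (p.lower + q.lower) + ((p.upper + q.upper) - 1 - (p.upper + a))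
      = q.lower + (q.upper - 1 - a) + p.lower
    omega
  · exact Nat.add_comm _ _

theorem good_tensor (m : ℕ) (E : Set ℤ)
    (hE2 : ∀ x k : ℤ, x ∈ E → x + m * k ∈ E) (p q : TCP) (hp : Good m E p) (hq : Good m E q) :
    Good m E (p.tensor q) := by
  refine ⟨?_, ?_, ?_⟩
  · have h1 : rsum (p.tensor q).lower (p.tensor q).loColor
        = rsum p.lower p.loColor + rsum q.lower q.loColor := rsum_add _ _ _ _
    have h2 : rsum (p.tensor q).upper (p.tensor q).upColor
        = rsum p.upper p.upColor + rsum q.upper q.upColor := rsum_add _ _ _ _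
    rw [h1, h2]
    obtain ⟨k, hk⟩ := hp.tot
    obtain ⟨l, hl⟩ := hq.tot
    exact ⟨k + l, by linear_combination hk + hl⟩
  · intro x y hxy
    rw [tensor_rel] at hxy
    rcases tensor_cases p q x with ⟨a, rfl⟩ | ⟨a, rfl⟩ <;>
      rcases tensor_cases p q y with ⟨b, rfl⟩ | ⟨b, rfl⟩ <;>
      simp only [ptmap_tinl, ptmap_tinr, sumRel] at hxy
    · rw [wt_tinl, wt_tinl]
      exact hp.blk _ _ hxy
    · obtain ⟨k, hk⟩ := wt_tinr p q m hp.tot a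
      obtain ⟨l, hl⟩ := wt_tinr p q m hp.tot b
      obtain ⟨t, ht⟩ := hq.blk _ _ hxy
      refine ⟨t + l - k, ?_⟩
      rw [hk, hl]
      linear_combination ht
  · intro x c y d hxy hcd hxc l1 l2 l3
    rw [tensor_rel] at hxy hcd hxc
    rcases tensor_cases p q x with ⟨x, rfl⟩ | ⟨x, rfl⟩ <;>
      rcases tensor_cases p q y with ⟨y, rfl⟩ | ⟨y, rfl⟩ <;>
      simp only [ptmap_tinl, ptmap_tinr, sumRel] at hxy <;>
      rcases tensor_cases p q c with ⟨c, rfl⟩ | ⟨c, rfl⟩ <;>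
      rcases tensor_cases p q d with ⟨d, rfl⟩ | ⟨d, rfl⟩ <;>
      simp only [ptmap_tinl, ptmap_tinr, sumRel] at hcd hxc
    · have h1 := pos_tinl p q x
      have h2 := pos_tinl p q y
      have h3 := pos_tinl p q c
      have h4 := pos_tinl p q d
      rw [wt_tinl, wt_tinl]
      exact hp.crs x c y d hxy hcd hxc (by omega) (by omega) (by omega)
    · exfalso
      have h1 := pos_tinl p q x
      have h2 := pos_tinl p q y
      have h3 := pos_tinr p q c
      have h4 := pos_tinr p q d
      have h5 := q.pos_lt c
      have h6 := q.pos_lt d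
      omega
    · exfalso
      have h1 := pos_tinr p q x
      have h2 := pos_tinr p q y
      have h3 := pos_tinl p q c
      have h4 := pos_tinl p q d
      have h5 := q.pos_lt x
      have h6 := q.pos_lt y
      omega
    · rw [pos_tinr, pos_tinr] at l1 l2 l3
      obtain ⟨k, hk⟩ := wt_tinr p q m hp.tot x
      obtain ⟨l, hl⟩ := wt_tinr p q m hp.tot c
      rw [hk, hl]
      intro hE
      refine hq.crs x c y d hxy hcd hxc (by omega) (by omega) (by omega) ?_
      have := hE2 _ (k - l) hE
      convert this using 1
      ring

/-! ### Composition -/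

/-- Join of the classes of two points. -/
def glue {Q : Type*} (s : Setoid Q) (a b : Q) : Setoid Q where
  r x y := s.r x y ∨ (s.r x a ∧ s.r b y) ∨ (s.r x b ∧ s.r a y)
  iseqv := by
    have hr := fun x => s.refl x
    have hs : ∀ {x y}, s.r x y → s.r y x := fun h => s.symm h
    have ht : ∀ {x y z}, s.r x y → s.r y z → s.r x z := fun h h' => s.trans h h'
    refine ⟨fun x => Or.inl (hr x), ?_, ?_⟩
    · rintro x y (h | ⟨h, h'⟩ | ⟨h, h'⟩)
      · exact Or.inl (hs h)
      · exact Or.inr (Or.inr ⟨hs h', hs h⟩)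
      · exact Or.inr (Or.inl ⟨hs h', hs h⟩)
    · rintro x y z (h | ⟨h, h'⟩ | ⟨h, h'⟩) (k | ⟨k, k'⟩ | ⟨k, k'⟩)
      · exact Or.inl (ht h k)
      · exact Or.inr (Or.inl ⟨ht h k, k'⟩)
      · exact Or.inr (Or.inr ⟨ht h k, k'⟩)
      · exact Or.inr (Or.inl ⟨h, ht h' k⟩)
      · exact Or.inr (Or.inl ⟨h, k'⟩)
      · exact Or.inl (ht h k')
      · exact Or.inr (Or.inr ⟨h, ht h' k⟩)
      · exact Or.inl (ht h k')
      · exact Or.inr (Or.inr ⟨h, k'⟩)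

def NC {Q : Type*} (ps : Q → ℕ) (D : Q → Q → Prop) (s : Setoid Q) (A : Q → Prop) : Prop :=
  ∀ x c y d, A x → A c → A y → A d → s.r x y → s.r c d → ¬ s.r x c →
    ps x < ps c → ps c < ps y → ps y < ps d → D x c

/-- Cyclic order of four numbers. -/
def Cyc (x c y d : ℕ) : Prop :=
  x < c ∧ c < y ∧ y < d ∨ c < y ∧ y < d ∧ d < x ∨ y < d ∧ d < x ∧ x < c ∨ d < x ∧ x < c ∧ c < y

theorem Cyc.split {x c y d : ℕ} (a b : ℕ) (hc : c < a ∧ c < b ∨ a < c ∧ b < c)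
    (hd : d < a ∧ d < b ∨ a < d ∧ b < d) (h : Cyc x c y d) : Cyc x c a d ∨ Cyc b c y d := by
  unfold Cyc at *
  rcases h with h | h | h | h <;> rcases hc with hc | hc <;> rcases hd with hd | hd <;>
    first
    | exact Or.inl (Or.inl (by omega))
    | exact Or.inl (Or.inr (Or.inl (by omega)))
    | exact Or.inl (Or.inr (Or.inr (Or.inl (by omega))))
    | exact Or.inl (Or.inr (Or.inr (Or.inr (by omega))))
    | exact Or.inr (Or.inl (by omega))
    | exact Or.inr (Or.inr (Or.inl (by omega)))
    | exact Or.inr (Or.inr (Or.inr (Or.inl (by omega))))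
    | exact Or.inr (Or.inr (Or.inr (Or.inr (by omega))))

theorem nc_glue {Q : Type*} {ps : Q → ℕ} {D : Q → Q → Prop} {s : Setoid Q} {A A' : Q → Prop}
    (h : NC ps D s A) (a b : Q) (ha : A a) (hb : A b) (hab : ps a < ps b)
    (hA : ∀ x, A' x → A x ∧ ps x ≠ ps a ∧ ps x ≠ ps b ∧ (ps x < ps a ∨ ps b < ps x))
    (hsymm : ∀ x y, D x y → D y x)
    (hD : ∀ x x' y y', (glue s a b).r x x' → (glue s a b).r y y' → D x y → D x' y') :
    NC ps D (glue s a b) A' := by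
  have hs : ∀ {x y}, s.r x y → s.r y x := fun h => s.symm h
  have ht : ∀ {x y z}, s.r x y → s.r y z → s.r x z := fun h h' => s.trans h h'
  have cyc : ∀ x c y d, A x → A c → A y → A d → s.r x y → s.r c d → ¬ s.r x c →
      Cyc (ps x) (ps c) (ps y) (ps d) →
      D x c := by
    intro x c y d Ax Ac Ay Ad r1 r2 hn ho
    have i1 : (TCP.glue s a b).r x y := Or.inl r1
    have i2 : (TCP.glue s a b).r c d := Or.inl r2
    have j1 := (TCP.glue s a b).symm i1
    have j2 := (TCP.glue s a b).symm i2
    rcases ho with ⟨l1, l2, l3⟩ | ⟨l1, l2, l3⟩ | ⟨l1, l2, l3⟩ | ⟨l1, l2, l3⟩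
    · exact h x c y d Ax Ac Ay Ad r1 r2 hn l1 l2 l3
    · have := h c y d x Ac Ay Ad Ax r2 (hs r1) (fun e => hn (ht r1 (hs e))) l1 l2 l3
      exact hsymm _ _ (hD _ _ _ _ ((TCP.glue s a b).refl _) j1 this)
    · have := h y d x c Ay Ad Ax Ac (hs r1) (hs r2)
        (fun e => hn (ht r1 (ht e (hs r2)))) l1 l2 l3
      exact hD _ _ _ _ j1 j2 this
    · have := h d x c y Ad Ax Ac Ay (hs r2) r1 (fun e => hn (hs (ht r2 e))) l1 l2 l3
      exact hsymm _ _ (hD _ _ _ _ j2 ((TCP.glue s a b).refl _) this)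
  have main : ∀ x c y d, A' x → A' c → A' y → A' d → (glue s a b).r x y →
      s.r c d → ¬ (glue s a b).r x c →
      Cyc (ps x) (ps c) (ps y) (ps d) →
      D x c := by
    intro x c y d Ax Ac Ay Ad r1 r2 hn ho
    obtain ⟨Ax, x1, x2, x3⟩ := hA _ Ax
    obtain ⟨Ac, c1, c2, c3⟩ := hA _ Ac
    obtain ⟨Ay, y1, y2, y3⟩ := hA _ Ay
    obtain ⟨Ad, d1, d2, d3⟩ := hA _ Ad
    have hn0 : ¬ s.r x c := fun e => hn (Or.inl e)
    have hny : ¬ s.r y c := fun e => hn ((TCP.glue s a b).trans r1 (Or.inl e))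
    rcases r1 with r1 | ⟨r1, r1'⟩ | ⟨r1, r1'⟩
    · exact cyc x c y d Ax Ac Ay Ad r1 r2 hn0 ho
    · rcases Cyc.split (ps a) (ps b) (by omega) (by omega) ho with hx | hx
      · exact cyc x c a d Ax Ac ha Ad r1 r2 hn0 hx
      · have := cyc b c y d hb Ac Ay Ad r1' r2 (fun e => hny (ht (hs r1') e)) hx
        exact hD _ _ _ _ (Or.inr (Or.inr ⟨s.refl _, hs r1⟩)) (Or.inl (s.refl _)) this
    · rcases Cyc.split (ps b) (ps a) (by omega) (by omega) ho with hx | hx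
      · exact cyc x c b d Ax Ac hb Ad r1 r2 hn0 hx
      · have := cyc a c y d ha Ac Ay Ad r1' r2 (fun e => hny (ht (hs r1') e)) hx
        exact hD _ _ _ _ (Or.inr (Or.inl ⟨s.refl _, hs r1⟩)) (Or.inl (s.refl _)) this
  intro x c y d Ax Ac Ay Ad r1 r2 hn l1 l2 l3
  by_cases hcd : s.r c d
  · exact main x c y d Ax Ac Ay Ad r1 hcd hn (Or.inl ⟨l1, l2, l3⟩)
  by_cases hxy : s.r x y
  · have := main c y d x Ac Ay Ad Ax r2 (hs hxy) (fun e => hn ((TCP.glue s a b).trans r1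
      ((TCP.glue s a b).symm e))) (Or.inr (Or.inr (Or.inr ⟨l1, l2, l3⟩)))
    exact hsymm _ _ (hD _ _ _ _ ((TCP.glue s a b).refl _) ((TCP.glue s a b).symm r1) this)
  exfalso
  have hx : (TCP.glue s a b).r x a := by
    rcases r1 with r1 | ⟨r1, r1'⟩ | ⟨r1, r1'⟩
    · exact (hxy r1).elim
    · exact Or.inl r1
    · exact Or.inr (Or.inr ⟨r1, s.refl _⟩)
  have hc : (TCP.glue s a b).r c a := by
    rcases r2 with r2 | ⟨r2, r2'⟩ | ⟨r2, r2'⟩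
    · exact (hcd r2).elim
    · exact Or.inl r2
    · exact Or.inr (Or.inr ⟨r2, s.refl _⟩)
  exact hn ((TCP.glue s a b).trans hx ((TCP.glue s a b).symm hc))

/-- Successive gluing of the first `k` middle points. -/
def glueN (p q : TCP) (h : p.upper = q.lower) : ℕ → Setoid (q.Point ⊕ p.Point)
  | 0 => sumSetoid q.rel p.rel
  | k + 1 => if hk : k < p.upper then
      glue (glueN p q h k) (Sum.inr (Sum.inl ⟨k, hk⟩)) (Sum.inl (Sum.inr (Fin.cast h ⟨k, hk⟩)))
    else glueN p q h k

theorem glueN_le_succ (p q : TCP) (h : p.upper = q.lower) (k : ℕ) (x y : q.Point ⊕ p.Point)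
    (hxy : (glueN p q h k).r x y) : (glueN p q h (k + 1)).r x y := by
  by_cases hk : k < p.upper
  · rw [glueN, dif_pos hk]
    exact Or.inl hxy
  · rw [glueN, dif_neg hk]
    exact hxy

theorem glueN_mono (p q : TCP) (h : p.upper = q.lower) (k l : ℕ) (hkl : k ≤ l)
    (x y : q.Point ⊕ p.Point) (hxy : (glueN p q h k).r x y) : (glueN p q h l).r x y := by
  induction l, hkl using Nat.le_induction with
  | base => exact hxy
  | succ l _ ih => exact glueN_le_succ p q h l x y ih

/-- A setoid containing the generators contains the gluings. -/
theorem glueN_le (p q : TCP) (h : p.upper = q.lower) (T : Setoid (q.Point ⊕ p.Point))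
    (hT : ∀ x y, compRel p q h x y → T.r x y) (k : ℕ) (x y : q.Point ⊕ p.Point)
    (hxy : (glueN p q h k).r x y) : T.r x y := by
  induction k generalizing x y with
  | zero =>
    apply hT
    rcases x with x | x <;> rcases y with y | y
    · exact Or.inl ⟨x, y, rfl, rfl, hxy⟩
    · exact hxy.elim
    · exact hxy.elim
    · exact Or.inr (Or.inl ⟨x, y, rfl, rfl, hxy⟩)
  | succ k ih =>
    by_cases hk : k < p.upper
    · rw [glueN, dif_pos hk] at hxy
      have hm := hT _ _ (Or.inr (Or.inr (Or.inr ⟨⟨k, hk⟩, rfl, rfl⟩)))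
      rcases hxy with e | ⟨e, e'⟩ | ⟨e, e'⟩
      · exact ih _ _ e
      · exact T.trans (ih _ _ e) (T.trans hm (ih _ _ e'))
      · exact T.trans (ih _ _ e) (T.trans (T.symm hm) (ih _ _ e'))
    · rw [glueN, dif_neg hk] at hxy
      exact ih _ _ hxy

theorem compRel_le_glueN (p q : TCP) (h : p.upper = q.lower) (x y : q.Point ⊕ p.Point)
    (hxy : compRel p q h x y) : (glueN p q h p.upper).r x y := by
  have key : ∀ j : Fin p.upper, (glueN p q h p.upper).r (Sum.inr (Sum.inl j))
      (Sum.inl (Sum.inr (Fin.cast h j))) := by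
    intro j
    apply glueN_mono p q h (j + 1) p.upper j.isLt
    rw [glueN, dif_pos j.isLt]
    exact Or.inr (Or.inl ⟨(glueN p q h j).refl _, (glueN p q h j).refl _⟩)
  rcases hxy with ⟨a, b, rfl, rfl, e⟩ | ⟨a, b, rfl, rfl, e⟩ | ⟨j, rfl, rfl⟩ | ⟨j, rfl, rfl⟩
  · exact glueN_mono p q h 0 _ (Nat.zero_le _) _ _ e
  · exact glueN_mono p q h 0 _ (Nat.zero_le _) _ _ e
  · exact (glueN p q h p.upper).symm (key j)
  · exact key j

theorem eqvGen_iff (p q : TCP) (h : p.upper = q.lower) (x y : q.Point ⊕ p.Point) :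
    Relation.EqvGen (compRel p q h) x y ↔ (glueN p q h p.upper).r x y := by
  constructor
  · intro e
    induction e with
    | rel x y e => exact compRel_le_glueN p q h x y e
    | refl x => exact (glueN p q h p.upper).refl x
    | symm x y _ ih => exact (glueN p q h p.upper).symm ih
    | trans x y z _ _ ih ih' => exact (glueN p q h p.upper).trans ih ih'
  · exact glueN_le p q h (Relation.EqvGen.setoid (compRel p q h))
      (fun x y e => Relation.EqvGen.rel x y e) _ x y

/-- Position on the circle obtained by placing `q` after `p`. -/
def pos2 (p q : TCP) : q.Point ⊕ p.Point → ℕ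
  | .inr x => p.pos x
  | .inl y => p.size + q.pos y

/-- Height on the union of points. -/
def wt2 (p q : TCP) : q.Point ⊕ p.Point → ℤ
  | .inr x => p.wt x
  | .inl y => q.wt y

/-- Points which have not been erased after `k` steps. -/
def alive (p q : TCP) (k : ℕ) : q.Point ⊕ p.Point → Prop
  | .inr (.inl j) => k ≤ j
  | .inl (.inr i) => k ≤ i
  | _ => True

/-- Heights are congruent. -/
def wcong (m : ℕ) (p q : TCP) : Setoid (q.Point ⊕ p.Point) where
  r x y := (m : ℤ) ∣ wt2 p q y - wt2 p q x
  iseqv := by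
    refine ⟨fun x => by simp, fun {x y} h => ?_, fun {x y z} h h' => ?_⟩
    · rw [← dvd_neg, neg_sub]
      exact h
    · obtain ⟨k, hk⟩ := h
      obtain ⟨l, hl⟩ := h'
      exact ⟨k + l, by linear_combination hk + hl⟩

theorem rh_cast {a b : ℕ} (h : a = b) (f : Fin a → Bool) (g : Fin b → Bool)
    (hfg : ∀ j, f j = g (Fin.cast h j)) (j : Fin a) : rh a f j = rh b g (Fin.cast h j) := by
  subst h
  have : f = g := funext hfg
  subst this
  rfl

theorem rsum_cast {a b : ℕ} (h : a = b) (f : Fin a → Bool) (g : Fin b → Bool)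
    (hfg : ∀ j, f j = g (Fin.cast h j)) : rsum a f = rsum b g := by
  subst h
  have : f = g := funext hfg
  subst this
  rfl

theorem compRel_wcong (m : ℕ) (E : Set ℤ) (p q : TCP) (h : Composable p q) (hp : Good m E p)
    (hq : Good m E q) (x y : q.Point ⊕ p.Point) (hxy : compRel p q h.len x y) :
    (wcong m p q).r x y := by
  have key : ∀ j : Fin p.upper, p.wt (Sum.inl j) = q.wt (Sum.inr (Fin.cast h.len j)) :=
    fun j => rh_cast h.len _ _ h.col j
  rcases hxy with ⟨a, b, rfl, rfl, e⟩ | ⟨a, b, rfl, rfl, e⟩ | ⟨j, rfl, rfl⟩ | ⟨j, rfl, rfl⟩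
  · exact hq.blk _ _ e
  · exact hp.blk _ _ e
  · change (m : ℤ) ∣ p.wt (Sum.inl j) - q.wt (Sum.inr (Fin.cast h.len j))
    rw [key, sub_self]
    exact dvd_zero _
  · change (m : ℤ) ∣ q.wt (Sum.inr (Fin.cast h.len j)) - p.wt (Sum.inl j)
    rw [key, sub_self]
    exact dvd_zero _

theorem nc_glueN (m : ℕ) (E : Set ℤ) (hE1 : ∀ x : ℤ, x ∈ E ↔ -x ∈ E)
    (hE2 : ∀ x k : ℤ, x ∈ E → x + m * k ∈ E) (p q : TCP) (h : Composable p q)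
    (hp : Good m E p) (hq : Good m E q) (k : ℕ) (hk : k ≤ p.upper) :
    NC (pos2 p q) (fun x y => wt2 p q y - wt2 p q x ∉ E) (glueN p q h.len k) (alive p q k) := by
  induction k with
  | zero =>
    intro x c y d _ _ _ _ hxy hcd hxc l1 l2 l3
    rcases x with x | x <;> rcases y with y | y <;> try exact hxy.elim
    · rcases c with c | c <;> rcases d with d | d <;> try exact hcd.elim
      · simp only [pos2] at l1 l2 l3
        exact hq.crs x c y d hxy hcd hxc (by omega) (by omega) (by omega)
      · have := p.pos_lt c
        simp only [pos2] at l1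
        omega
    · rcases c with c | c <;> rcases d with d | d <;> try exact hcd.elim
      · have := p.pos_lt y
        simp only [pos2] at l2
        omega
      · exact hp.crs x c y d hxy hcd hxc l1 l2 l3
  | succ k ih =>
    have hlen := h.len
    have hk' : k < p.upper := hk
    have hW := glueN_le p q h.len (wcong m p q) (compRel_wcong m E p q h hp hq) (k + 1)
    rw [glueN, dif_pos hk'] at hW ⊢
    refine nc_glue (ih hk'.le) _ _ ?_ ?_ ?_ ?_ ?_ ?_
    · exact le_refl k
    · exact le_refl k
    · simp only [pos2, pos, size, Fin.val_cast]
      omega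
    · rintro ((⟨x, hx⟩ | ⟨x, hx⟩) | (⟨x, hx⟩ | ⟨x, hx⟩)) hA <;>
        simp only [alive, pos2, pos, size, Fin.val_cast, true_and] at hA ⊢ <;> omega
    · intro x y hD hE
      apply hD
      rw [hE1, neg_sub]
      exact hE
    · intro x x' y y' hx hy hD hE
      apply hD
      obtain ⟨k1, hk1⟩ := hW _ _ hx
      obtain ⟨k2, hk2⟩ := hW _ _ hy
      have := hE2 _ (k1 - k2) hE
      convert this using 1
      linear_combination hk1 - hk2

/-- The points of a composition inside the union of points. -/
def cmap (p q : TCP) : Fin q.upper ⊕ Fin p.lower → q.Point ⊕ p.Point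
  | .inl j => Sum.inl (Sum.inl j)
  | .inr i => Sum.inr (Sum.inr i)

theorem comp_rel (p q : TCP) (h : Composable p q) (x y : (comp p q h).Point) :
    (comp p q h).rel.r x y ↔ (glueN p q h.len p.upper).r (cmap p q x) (cmap p q y) := by
  rw [← eqvGen_iff]
  rcases x with x | x <;> rcases y with y | y <;> exact Iff.rfl

theorem good_comp (m : ℕ) (E : Set ℤ) (hE1 : ∀ x : ℤ, x ∈ E ↔ -x ∈ E)
    (hE2 : ∀ x k : ℤ, x ∈ E → x + m * k ∈ E) (p q : TCP) (h : Composable p q)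
    (hp : Good m E p) (hq : Good m E q) : Good m E (comp p q h) := by
  have hw : ∀ x : (comp p q h).Point, (comp p q h).wt x = wt2 p q (cmap p q x) := by
    rintro (x | x) <;> rfl
  have hps : ∀ x y : (comp p q h).Point, (comp p q h).pos x < (comp p q h).pos y →
      pos2 p q (cmap p q x) < pos2 p q (cmap p q y) := by
    rintro (⟨x, hx⟩ | ⟨x, hx⟩) (⟨y, hy⟩ | ⟨y, hy⟩) hxy <;> simp only [comp] at hx hy <;>
      simp only [pos, pos2, cmap, size, comp] at hxy ⊢ <;> omega
  have hal : ∀ x : (comp p q h).Point, alive p q p.upper (cmap p q x) := by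
    rintro (x | x) <;> trivial
  refine ⟨?_, ?_, ?_⟩
  · obtain ⟨k, hk⟩ := hp.tot
    obtain ⟨l, hl⟩ := hq.tot
    rw [rsum_cast h.len _ _ h.col] at hk
    change (m : ℤ) ∣ rsum p.lower p.loColor - rsum q.upper q.upColor
    exact ⟨k + l, by linear_combination hk + hl⟩
  · intro x y hxy
    rw [hw, hw]
    rw [comp_rel] at hxy
    exact glueN_le p q h.len (wcong m p q) (compRel_wcong m E p q h hp hq) _ _ _ hxy
  · intro x c y d hxy hcd hxc l1 l2 l3
    rw [comp_rel] at hxy hcd hxc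
    rw [hw, hw]
    exact nc_glueN m E hE1 hE2 p q h hp hq p.upper le_rfl _ _ _ _ (hal x) (hal c) (hal y) (hal d)
      hxy hcd hxc (hps _ _ l1) (hps _ _ l2) (hps _ _ l3)

end TCP

/-- for E ⊆ ℤ with E = −E = E + mℤ, the partitions with same-block
color distances in mℤ and crossing-block color distances outside E form a category. -/
theorem stmt16 (m : ℕ) (E : Set ℤ) (hE1 : ∀ x : ℤ, x ∈ E ↔ -x ∈ E)
    (hE2 : ∀ x k : ℤ, x ∈ E → x + m * k ∈ E) :
    TCP.IsCategory {p : TCP |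
      (∀ B : Finset p.Point, p.IsBlock B → ∀ a ∈ B, ∀ b ∈ B, (m : ℤ) ∣ p.cdist a b) ∧
      (∀ B₁ B₂ : Finset p.Point, p.IsBlock B₁ → p.IsBlock B₂ → B₁ ≠ B₂ →
        p.Cross B₁ B₂ → ∀ a ∈ B₁, ∀ b ∈ B₂, p.cdist a b ∉ E)} := by
  have key := TCP.good_iff m E hE1 hE2
  simp only [key]
  exact ⟨TCP.good_empty m E, TCP.good_id m E true, TCP.good_id m E false,
    TCP.good_lpair m E true, TCP.good_lpair m E false,
    fun p q hp hq => TCP.good_tensor m E hE2 p q hp hq,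
    fun p hp => TCP.good_invol m E hE1 hE2 p hp,
    fun p q h hp hq => TCP.good_comp m E hE1 hE2 p q h hp hq⟩
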